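/- Let A be an ε-bialgebra over a commutative ring k. On the k-module End(A) of k-linear endomorphisms of A, define the convolution T ∗ S := μ(T ⊗ S)Δ, i.e. (T ∗ S)(a) = T(a₁)·S(a₂), and set T ≻ S := (id ∗ T ∗ id)∘S + (id ∗ T)∘(S ∗ id) and T ≺ S := T∘(id ∗ S ∗ id) + (T ∗ id)∘(id ∗ S), where juxtaposition of endomorphisms denotes composition and id ∗ T ∗ id means (id ∗ T) ∗ id. Then (End(A), ≻, ≺) is a dendriform algebra. -/

import Mathlib

open TensorProduct

/-- The convolution `T ∗ S = μ(T ⊗ S)Δ` of two linear endomorphisms of an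
ε-bialgebra `A`. -/
noncomputable def conv (k : Type*) {A : Type*} [CommRing k] [NonUnitalRing A]
    [Module k A] [SMulCommClass k A A] [IsScalarTower k A A]
    (Δ : A →ₗ[k] A ⊗[k] A) (T S : A →ₗ[k] A) : A →ₗ[k] A :=
  (TensorProduct.lift (LinearMap.mul k A)).comp ((TensorProduct.map T S).comp Δ)

/-- A Rota–Baxter operator of weight zero satisfies `P x * P y = P (P x * y + x * P y)`. Two commuting
such operators `L`, `R` on a ring make it a dendriform algebra under
`x ≻ y = R (L x) * y + L x * R y` and `x ≺ y = x * R (L y) + R x * L y`. -/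
theorem dendriform_of_commuting_rotaBaxter {E : Type*} [NonUnitalRing E] (L R : E →+ E)
    (hLR : ∀ x, L (R x) = R (L x))
    (hL : ∀ x y, L x * L y = L (L x * y) + L (x * L y))
    (hR : ∀ x y, R x * R y = R (R x * y) + R (x * R y))
    (succ prec : E → E → E)
    (hsucc : ∀ x y, succ x y = R (L x) * y + L x * R y)
    (hprec : ∀ x y, prec x y = x * R (L y) + R x * L y) :
    (∀ x y z, prec (prec x y) z = prec x (prec y z) + prec x (succ y z))
    ∧ (∀ x y z, succ x (prec y z) = prec (succ x y) z)
    ∧ (∀ x y z, succ x (succ y z) = succ (prec x y) z + succ (succ x y) z) := by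
  have L_add (y z : E) : L (prec y z) + L (succ y z) = R (L y) * L z + L y * R (L z) := by
    have h₁ := hL (R y) z
    have h₂ := hL y (R z)
    simp only [hLR] at h₁ h₂
    rw [h₁, h₂, hprec, hsucc, map_add, map_add]
    abel
  have RL_add (y z : E) : R (L (prec y z)) + R (L (succ y z)) = R (L y) * R (L z) := by
    rw [← map_add, L_add, hR, map_add]
  have R_prec (y z : E) : R (prec y z) = R y * R (L z) := by
    rw [hprec, hR, map_add, add_comm]
  have R_succ (y z : E) : R (succ y z) = R (L y) * R z := by
    rw [hsucc, hR, map_add]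
  refine ⟨fun x y z => ?_, fun x y z => ?_, fun x y z => ?_⟩
  · have : prec x (prec y z) + prec x (succ y z)
        = x * (R (L (prec y z)) + R (L (succ y z))) + R x * (L (prec y z) + L (succ y z)) := by
      rw [hprec x, hprec x]
      noncomm_ring
    rw [this, RL_add, L_add, hprec (prec x y), R_prec, hprec x y]
    noncomm_ring
  · rw [hsucc x (prec y z), R_prec, hprec (succ x y), R_succ, hsucc x y, hprec y z]
    noncomm_ring
  · have : succ (prec x y) z + succ (succ x y) z
        = (R (L (prec x y)) + R (L (succ x y))) * z + (L (prec x y) + L (succ x y)) * R z := by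
      rw [hsucc (prec x y), hsucc (succ x y)]
      noncomm_ring
    rw [this, RL_add, L_add, hsucc x (succ y z), R_succ, hsucc y z]
    noncomm_ring

section Convolution

variable {k A : Type*} [CommRing k] [NonUnitalRing A] [Module k A] [SMulCommClass k A A]
  [IsScalarTower k A A] {Δ : A →ₗ[k] A ⊗[k] A}

theorem conv_apply (T S : A →ₗ[k] A) (a : A) :
    conv k Δ T S a = TensorProduct.lift (LinearMap.mul k A) (TensorProduct.map T S (Δ a)) :=
  rfl

theorem conv_add_left (T T' S : A →ₗ[k] A) :
    conv k Δ (T + T') S = conv k Δ T S + conv k Δ T' S := by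
  simp only [conv, TensorProduct.map_add_left, LinearMap.add_comp, LinearMap.comp_add]

theorem conv_add_right (T S S' : A →ₗ[k] A) :
    conv k Δ T (S + S') = conv k Δ T S + conv k Δ T S' := by
  simp only [conv, TensorProduct.map_add_right, LinearMap.add_comp, LinearMap.comp_add]

theorem conv_assoc
    (hcoassoc : ∀ a : A,
      (TensorProduct.assoc k A A A) ((TensorProduct.map Δ LinearMap.id) (Δ a)) =
        (TensorProduct.map LinearMap.id Δ) (Δ a))
    (T S R : A →ₗ[k] A) :
    conv k Δ (conv k Δ T S) R = conv k Δ T (conv k Δ S R) := by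
  let m : A ⊗[k] A →ₗ[k] A := TensorProduct.lift (LinearMap.mul k A)
  have hm (x : (A ⊗[k] A) ⊗[k] A) :
      m (TensorProduct.map (m ∘ₗ TensorProduct.map T S) R x)
        = m (TensorProduct.map T (m ∘ₗ TensorProduct.map S R) (TensorProduct.assoc k A A A x)) := by
    refine LinearMap.congr_fun (f := m ∘ₗ TensorProduct.map (m ∘ₗ TensorProduct.map T S) R)
      (g := m ∘ₗ TensorProduct.map T (m ∘ₗ TensorProduct.map S R) ∘ₗ
        (TensorProduct.assoc k A A A).toLinearMap) ?_ x
    ext a b c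
    simp [m, mul_assoc]
  ext a
  have h := hm (TensorProduct.map Δ LinearMap.id (Δ a))
  rw [hcoassoc] at h
  simp only [← LinearMap.comp_apply, ← LinearMap.comp_assoc] at h
  simpa only [conv, m, LinearMap.comp_apply, TensorProduct.map_map, LinearMap.comp_id,
    LinearMap.comp_assoc] using h

theorem conv_id_left_comp
    (hcoassoc : ∀ a : A,
      (TensorProduct.assoc k A A A) ((TensorProduct.map Δ LinearMap.id) (Δ a)) =
        (TensorProduct.map LinearMap.id Δ) (Δ a))
    (hder : ∀ a b : A,
      Δ (a * b) = (TensorProduct.map (LinearMap.mulLeft k a) LinearMap.id) (Δ b)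
        + (TensorProduct.map LinearMap.id (LinearMap.mulRight k b)) (Δ a))
    (T S : A →ₗ[k] A) :
    conv k Δ LinearMap.id T ∘ₗ conv k Δ LinearMap.id S
      = conv k Δ LinearMap.id (conv k Δ LinearMap.id T ∘ₗ S)
        + conv k Δ LinearMap.id (T ∘ₗ conv k Δ LinearMap.id S) := by
  let m : A ⊗[k] A →ₗ[k] A := TensorProduct.lift (LinearMap.mul k A)
  let φ : A ⊗[k] (A ⊗[k] A) →ₗ[k] A :=
    m ∘ₗ TensorProduct.map LinearMap.id (T ∘ₗ m ∘ₗ TensorProduct.map LinearMap.id S)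
  have mulLeft_part (a : A) (y : A ⊗[k] A) :
      m (TensorProduct.map LinearMap.id T (TensorProduct.map (LinearMap.mulLeft k a) LinearMap.id y))
        = a * m (TensorProduct.map LinearMap.id T y) := by
    induction y with
    | zero => simp
    | add y z hy hz => simp only [map_add, hy, hz, mul_add]
    | tmul b c => simp [m, mul_assoc]
  have mulRight_part (b : A) (y : A ⊗[k] A) :
      m (TensorProduct.map LinearMap.id T
        (TensorProduct.map LinearMap.id (LinearMap.mulRight k (S b)) y))
        = φ (TensorProduct.assoc k A A A (y ⊗ₜ b)) := by
    induction y with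
    | zero => simp
    | add y z hy hz => simp only [map_add, hy, hz, TensorProduct.add_tmul]
    | tmul a c => simp [m, φ]
  have key (x : A ⊗[k] A) :
      conv k Δ LinearMap.id T (m (TensorProduct.map LinearMap.id S x))
        = m (TensorProduct.map LinearMap.id (conv k Δ LinearMap.id T ∘ₗ S) x)
          + φ (TensorProduct.assoc k A A A (TensorProduct.map Δ LinearMap.id x)) := by
    induction x with
    | zero => simp
    | add y z hy hz => simp only [map_add, hy, hz]; abel
    | tmul a b =>
      have hm (c d : A) : m (c ⊗ₜ d) = c * d := by simp [m]
      simp only [TensorProduct.map_tmul, hm, LinearMap.id_apply, LinearMap.comp_apply]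
      rw [conv_apply, hder, map_add, map_add, conv_apply, ← mulRight_part, ← mulLeft_part]
  ext a
  have h := key (Δ a)
  rw [hcoassoc] at h
  simpa only [conv, m, φ, LinearMap.comp_apply, LinearMap.add_apply, TensorProduct.map_map,
    LinearMap.comp_id, LinearMap.comp_assoc] using h

theorem conv_id_right_comp
    (hcoassoc : ∀ a : A,
      (TensorProduct.assoc k A A A) ((TensorProduct.map Δ LinearMap.id) (Δ a)) =
        (TensorProduct.map LinearMap.id Δ) (Δ a))
    (hder : ∀ a b : A,
      Δ (a * b) = (TensorProduct.map (LinearMap.mulLeft k a) LinearMap.id) (Δ b)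
        + (TensorProduct.map LinearMap.id (LinearMap.mulRight k b)) (Δ a))
    (T S : A →ₗ[k] A) :
    conv k Δ T LinearMap.id ∘ₗ conv k Δ S LinearMap.id
      = conv k Δ (conv k Δ T LinearMap.id ∘ₗ S) LinearMap.id
        + conv k Δ (T ∘ₗ conv k Δ S LinearMap.id) LinearMap.id := by
  let m : A ⊗[k] A →ₗ[k] A := TensorProduct.lift (LinearMap.mul k A)
  let φ : (A ⊗[k] A) ⊗[k] A →ₗ[k] A :=
    m ∘ₗ TensorProduct.map (T ∘ₗ m ∘ₗ TensorProduct.map S LinearMap.id) LinearMap.id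
  have mulRight_part (b : A) (y : A ⊗[k] A) :
      m (TensorProduct.map T LinearMap.id (TensorProduct.map LinearMap.id (LinearMap.mulRight k b) y))
        = m (TensorProduct.map T LinearMap.id y) * b := by
    induction y with
    | zero => simp
    | add y z hy hz => simp only [map_add, hy, hz, add_mul]
    | tmul a c => simp [m, mul_assoc]
  have mulLeft_part (a : A) (y : A ⊗[k] A) :
      m (TensorProduct.map T LinearMap.id
        (TensorProduct.map (LinearMap.mulLeft k (S a)) LinearMap.id y))
        = φ ((TensorProduct.assoc k A A A).symm (a ⊗ₜ y)) := by
    induction y with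
    | zero => simp
    | add y z hy hz => simp only [map_add, hy, hz, TensorProduct.tmul_add]
    | tmul b c => simp [m, φ]
  have key (x : A ⊗[k] A) :
      conv k Δ T LinearMap.id (m (TensorProduct.map S LinearMap.id x))
        = m (TensorProduct.map (conv k Δ T LinearMap.id ∘ₗ S) LinearMap.id x)
          + φ ((TensorProduct.assoc k A A A).symm (TensorProduct.map LinearMap.id Δ x)) := by
    induction x with
    | zero => simp
    | add y z hy hz => simp only [map_add, hy, hz]; abel
    | tmul a b =>
      have hm (c d : A) : m (c ⊗ₜ d) = c * d := by simp [m]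
      simp only [TensorProduct.map_tmul, hm, LinearMap.id_apply, LinearMap.comp_apply]
      rw [conv_apply, hder, map_add, map_add, conv_apply, ← mulRight_part, ← mulLeft_part, add_comm]
  ext a
  have h := key (Δ a)
  rw [← hcoassoc, LinearEquiv.symm_apply_apply] at h
  simpa only [conv, m, φ, LinearMap.comp_apply, LinearMap.add_apply, TensorProduct.map_map,
    LinearMap.comp_id, LinearMap.comp_assoc] using h

end Convolution

/-- For any ε-bialgebra `A`, the operations
`T ≻ S = (id∗T∗id)∘S + (id∗T)∘(S∗id)` and `T ≺ S = T∘(id∗S∗id) + (T∗id)∘(id∗S)`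
make `End(A)` a dendriform algebra. -/
theorem end_dendriform {k A : Type*} [CommRing k] [NonUnitalRing A]
    [Module k A] [SMulCommClass k A A] [IsScalarTower k A A]
    (Δ : A →ₗ[k] A ⊗[k] A)
    (hcoassoc : ∀ a : A,
      (TensorProduct.assoc k A A A) ((TensorProduct.map Δ LinearMap.id) (Δ a)) =
        (TensorProduct.map LinearMap.id Δ) (Δ a))
    (hder : ∀ a b : A,
      Δ (a * b) = (TensorProduct.map (LinearMap.mulLeft k a) LinearMap.id) (Δ b)
        + (TensorProduct.map LinearMap.id (LinearMap.mulRight k b)) (Δ a))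
    (succ prec : (A →ₗ[k] A) → (A →ₗ[k] A) → (A →ₗ[k] A))
    (hsucc : ∀ T S : A →ₗ[k] A,
      succ T S = (conv k Δ (conv k Δ LinearMap.id T) LinearMap.id).comp S
        + (conv k Δ LinearMap.id T).comp (conv k Δ S LinearMap.id))
    (hprec : ∀ T S : A →ₗ[k] A,
      prec T S = T.comp (conv k Δ (conv k Δ LinearMap.id S) LinearMap.id)
        + (conv k Δ T LinearMap.id).comp (conv k Δ LinearMap.id S)) :
    (∀ T S R : A →ₗ[k] A, prec (prec T S) R = prec T (prec S R) + prec T (succ S R))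
    ∧ (∀ T S R : A →ₗ[k] A, succ T (prec S R) = prec (succ T S) R)
    ∧ (∀ T S R : A →ₗ[k] A,
        succ T (succ S R) = succ (prec T S) R + succ (succ T S) R) := by
  exact dendriform_of_commuting_rotaBaxter (E := Module.End k A)
    (AddMonoidHom.mk' (fun T => conv k Δ LinearMap.id T) fun T S => conv_add_right _ T S)
    (AddMonoidHom.mk' (fun T => conv k Δ T LinearMap.id) fun T S => conv_add_left T S _)
    (fun T => (conv_assoc hcoassoc LinearMap.id T LinearMap.id).symm)
    (conv_id_left_comp hcoassoc hder) (conv_id_right_comp hcoassoc hder) succ prec hsucc hprec
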